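/- arXiv:1206.0955 — 2 statements merged into one kernel-verified Lean document; each statement's English description precedes it below -/
import Mathlib

section
/- Let M be a von Neumann algebra, φ a faithful normal state, and t₁ < t₂ < ⋯ < tₙ real numbers. Suppose unitaries u₁, …, uₙ ∈ M satisfy ‖u_j − u_{j+1}‖_φ^♯ < ε for j = 1, …, n−1, where ‖x‖_φ^♯ := (φ(x*x)/2 + φ(xx*)/2)^{1/2}. Then there exists a strongly continuous path of unitaries u : [t₁, tₙ] → M with u(t_j) = u_j for all j and ‖u(t) − u(t_j)‖_φ^♯ < √2 · ε^{1/2} for all t ∈ [t_j, t_{j+1}]. If moreover ‖u_i − u_j‖_φ^♯ < ε for all i, j, then ‖u(s) − u(t)‖_φ^♯ < 4 ε^{1/2} for all s, t ∈ [t₁, tₙ]. -/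
namespace Stmt3

variable {H : Type*} [NormedAddCommGroup H] [InnerProductSpace ℂ H] [CompleteSpace H]

/-- The ♯-seminorm ‖x‖_φ^♯ = ((φ(x*x) + φ(xx*))/2)^{1/2} associated to a state φ. -/
noncomputable def sharpNorm (φ : (H →L[ℂ] H) →ₗ[ℂ] ℂ) (x : H →L[ℂ] H) : ℝ :=
  Real.sqrt (((φ (star x * x)).re + (φ (x * star x)).re) / 2)

lemma mem_of_comm (M : VonNeumannAlgebra H) (x : H →L[ℂ] H)
    (h : ∀ y ∈ M.commutant, y * x = x * y) : x ∈ M := by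
  rw [← M.commutant_commutant]
  exact VonNeumannAlgebra.mem_commutant_iff.2 h

lemma ker_proj (T : H →L[ℂ] H) : ∃ p : H →L[ℂ] H, star p = p ∧ p * p = p ∧ T * p = 0 ∧
    (∀ x, T * x = 0 → p * x = x) ∧
    (∀ y, y * T = T * y → star y * T = T * star y → y * p = p * y) := by
  have hc : CompleteSpace T.ker := T.isClosed_ker.completeSpace_coe
  let p := T.ker.starProjection
  have h1 : star p = p := (isSelfAdjoint_starProjection T.ker).star_eq
  have h2 : p * p = p := T.ker.isIdempotentElem_starProjection
  have h3 : T * p = 0 := by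
    ext v
    exact T.ker.starProjection_apply_mem v
  have h4 : ∀ x, T * x = 0 → p * x = x := by
    intro x hx
    ext v
    refine Submodule.starProjection_eq_self_iff.2 ?_
    exact congr($hx v)
  refine ⟨p, h1, h2, h3, h4, ?_⟩
  intro y hy hy'
  have e1 : p * (y * p) = y * p := h4 _ (by rw [← mul_assoc, ← hy, mul_assoc, h3, mul_zero])
  have e2 : p * (star y * p) = star y * p :=
    h4 _ (by rw [← mul_assoc, ← hy', mul_assoc, h3, mul_zero])
  have e3 := congr(star $e2)
  simp only [star_mul, star_star, h1] at e3
  rw [← e1, ← mul_assoc, e3]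

lemma cfc_cont (a : H →L[ℂ] H) (f : ℝ → ℝ) (g : ℝ → ℝ) (hg : ∀ x y, |g x - g y| ≤ |x - y|)
    (hf : Continuous f) (C : ℝ) (hC : ∀ x, |f x| ≤ C) :
    Continuous (fun θ : ℝ => cfc (fun x => g (θ * f x)) a) := by
  have hg' : Continuous g := by
    have : LipschitzWith 1 g := LipschitzWith.of_dist_le_mul (fun x y => by
      simpa [Real.dist_eq] using hg x y)
    exact this.continuous
  rw [continuous_iff_continuousAt]
  intro θ₀
  apply continuousAt_cfc_fun
  · rw [Metric.tendstoUniformlyOn_iff]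
    intro e he
    have hC0 : 0 ≤ C := (abs_nonneg _).trans (hC 0)
    filter_upwards [Metric.ball_mem_nhds θ₀ (show 0 < e / (C + 1) by positivity)] with θ hθ x _
    rw [Metric.mem_ball, Real.dist_eq, lt_div_iff₀ (by positivity)] at hθ
    rw [dist_comm, Real.dist_eq]
    refine (hg _ _).trans_lt ?_
    rw [← sub_mul, abs_mul]
    have := mul_le_mul_of_nonneg_left (hC x) (abs_nonneg (θ - θ₀))
    nlinarith [abs_nonneg (θ - θ₀)]
  · exact Filter.Eventually.of_forall fun θ => by fun_prop

lemma unitary_arc (M : VonNeumannAlgebra H) [Nontrivial (H →L[ℂ] H)] (w : H →L[ℂ] H) (hwM : w ∈ M)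
    (h1 : star w * w = 1) (h2 : w * star w = 1) :
    ∃ W : ℝ → H →L[ℂ] H, Continuous W ∧ (∀ θ, W θ ∈ M) ∧
      (∀ θ, star (W θ) * W θ = 1 ∧ W θ * star (W θ) = 1) ∧ W 0 = 1 ∧ W 1 = w ∧
      ∀ θ ∈ Set.Icc (0:ℝ) 1, ∃ d, w + star w + star d * d = W θ + star (W θ) := by
  have hnw : ‖w‖ = 1 := CStarRing.norm_of_mem_unitary (Unitary.mem_iff.2 ⟨h1, h2⟩)
  obtain ⟨a, ha⟩ : ∃ a : H →L[ℂ] H, a = (1/2 : ℂ) • (w + star w) := ⟨_, rfl⟩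
  obtain ⟨c, hc⟩ : ∃ c : H →L[ℂ] H, c = (1/2 : ℂ) • (w - star w) := ⟨_, rfl⟩
  have hsa : star a = a := by
    rw [ha, star_smul, star_add, star_star, add_comm]; simp
  have hsc : star c = -c := by
    rw [hc, star_smul, star_sub, star_star, ← smul_neg, neg_sub]; simp
  have hac : a + c = w := by rw [ha, hc]; module
  have hww : w + star w = 2 * a := by rw [ha, two_mul]; module
  have hcomm : a * c = c * a := by
    rw [ha, hc]; simp only [smul_mul_smul_comm, mul_add, mul_sub, add_mul, sub_mul, h1, h2]; abel_nf
  have hcc : c * c = a * a - 1 := by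
    rw [ha, hc]; simp only [smul_mul_smul_comm, mul_add, mul_sub, add_mul, sub_mul, h1, h2]
    module
  have hSA : IsSelfAdjoint a := hsa
  have hspec : ∀ x ∈ spectrum ℝ a, -1 ≤ x ∧ x ≤ 1 := by
    intro x hx
    have hh := spectrum.norm_le_norm_of_mem hx
    have : ‖a‖ ≤ 1 := by
      rw [ha, norm_smul]
      have := norm_add_le w (star w)
      rw [norm_star, hnw] at this
      norm_num
      linarith
    exact abs_le.1 (hh.trans this)
  let F : ℝ → H →L[ℂ] H := fun θ => cfc (fun x => Real.cos (θ * Real.arccos x)) a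
  let G : ℝ → H →L[ℂ] H := fun θ => cfc (fun x => Real.sin (θ * Real.arccos x)) a
  have hfc : ∀ θ : ℝ, Continuous (fun x => Real.cos (θ * Real.arccos x)) := fun θ =>
    Real.continuous_cos.comp (continuous_const.mul Real.continuous_arccos)
  have hgc : ∀ θ : ℝ, Continuous (fun x => Real.sin (θ * Real.arccos x)) := fun θ =>
    Real.continuous_sin.comp (continuous_const.mul Real.continuous_arccos)
  have hFs : ∀ θ, star (F θ) = F θ := fun θ => (cfc_predicate _ a : IsSelfAdjoint _).star_eq
  have hGs : ∀ θ, star (G θ) = G θ := fun θ => (cfc_predicate _ a : IsSelfAdjoint _).star_eq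
  have hFG : ∀ θ, F θ * G θ = G θ * F θ := fun θ => (cfc_commute_cfc _ _ a)
  have hFFGG : ∀ θ, F θ * F θ + G θ * G θ = 1 := by
    intro θ
    have hf := (hfc θ).continuousOn (s := spectrum ℝ a)
    have hg := (hgc θ).continuousOn (s := spectrum ℝ a)
    simp only [F, G]
    rw [← cfc_mul _ _ a hf hf, ← cfc_mul _ _ a hg hg, ← cfc_add a (fun x => Real.cos (θ * Real.arccos x) * Real.cos (θ * Real.arccos x))
      (fun x => Real.sin (θ * Real.arccos x) * Real.sin (θ * Real.arccos x)) (hf.mul hf) (hg.mul hg)]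
    rw [← cfc_one ℝ a]
    refine cfc_congr fun x _ => ?_
    simp only [Pi.one_apply]
    nlinarith [Real.sin_sq_add_cos_sq (θ * Real.arccos x)]
  have hF1 : F 1 = a := by
    simp only [F]
    conv_rhs => rw [← cfc_id ℝ a]
    refine cfc_congr fun x hx => ?_
    simp [Real.cos_arccos (hspec x hx).1 (hspec x hx).2]
  have hF0 : F 0 = 1 := by simp [F, cfc_const_one ℝ a]
  have hG0 : G 0 = 0 := by simp [G, cfc_const_zero ℝ a]
  have hGM : ∀ y, a * y = y * a → ∀ θ, G θ * y = y * G θ :=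
    fun y hy θ => Commute.cfc_real (show Commute a y from hy) _
  have hFM : ∀ y, a * y = y * a → ∀ θ, F θ * y = y * F θ :=
    fun y hy θ => Commute.cfc_real (show Commute a y from hy) _
  have hy0 : ∀ y ∈ M.commutant, w * y = y * w ∧ star w * y = y * star w := fun y hy =>
    ⟨VonNeumannAlgebra.mem_commutant_iff.1 hy w hwM,
      VonNeumannAlgebra.mem_commutant_iff.1 hy _ (star_mem hwM)⟩
  have hya : ∀ y ∈ M.commutant, a * y = y * a := fun y hy => by
    rw [ha, smul_mul_assoc, mul_smul_comm, add_mul, mul_add, (hy0 y hy).1, (hy0 y hy).2]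
  have hyc : ∀ y ∈ M.commutant, c * y = y * c := fun y hy => by
    rw [hc, smul_mul_assoc, mul_smul_comm, sub_mul, mul_sub, (hy0 y hy).1, (hy0 y hy).2]
  -- the sign symmetry
  obtain ⟨k, hk⟩ : ∃ k : H →L[ℂ] H, k = Complex.I • G 1 := ⟨_, rfl⟩
  have hkk : k * k = c * c := by
    rw [hk, smul_mul_smul_comm, Complex.I_mul_I, hcc, ← hF1, ← hFFGG 1]
    simp
  have hkcomm : ∀ y, a * y = y * a → k * y = y * k := fun y hy => by
    rw [hk, smul_mul_assoc, mul_smul_comm, hGM y hy]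
  have hkc : k * c = c * k := hkcomm c hcomm
  obtain ⟨p, hp1, hp2, hp3, hp4, hp5⟩ := ker_proj (k - c)
  have hpM : ∀ y ∈ M.commutant, y * p = p * y := by
    have key : ∀ y ∈ M.commutant, y * (k - c) = (k - c) * y := fun y hy => by
      rw [mul_sub, sub_mul, hkcomm y (hya y hy), hyc y hy]
    exact fun y hy => hp5 y (key y hy) (key _ (star_mem hy))
  have hka : a * (k - c) = (k - c) * a := by rw [mul_sub, sub_mul, hcomm, hkcomm a rfl]
  have hpa : a * p = p * a := hp5 a hka (by rw [hsa]; exact hka)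
  have hk_sa : star k = -k := by rw [hk, star_smul, hGs]; simp
  have hkcp : (k - c) * p = p * (k - c) := by
    have e : star (k - c) = -(k - c) := by rw [star_sub, hk_sa, hsc]; abel
    exact hp5 _ rfl (by rw [e, neg_mul, mul_neg])
  have hq1 : p * (k + c) = k + c := hp4 _ (by
    rw [sub_mul, mul_add, mul_add, hkk, hkc]; abel)
  have hq2 : p * (k - c) = 0 := by rw [← hkcp, hp3]
  obtain ⟨s, hs⟩ : ∃ s : H →L[ℂ] H, s = p + p - 1 := ⟨_, rfl⟩
  have hsk : s * k = c := by
    have e : p * k + p * k = k + c := by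
      rw [← add_zero (k + c), ← hq1, ← hq2, mul_add, mul_sub]
      abel
    rw [hs, sub_mul, add_mul, e]; simp
  have hss : s * s = 1 := by
    rw [hs]; simp only [mul_add, mul_sub, add_mul, sub_mul, hp2, mul_one, one_mul]; abel
  have hsst : star s = s := by rw [hs]; simp [hp1]
  have hsa' : a * s = s * a := by
    rw [hs]; simp only [mul_add, mul_sub, add_mul, sub_mul, hpa, mul_one, one_mul]
  have hsM : ∀ y ∈ M.commutant, y * s = s * y := fun y hy => by
    rw [hs]; simp only [mul_add, mul_sub, add_mul, sub_mul, hpM y hy, mul_one, one_mul]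
  have hGsc := hGM s hsa'
  have hFsc := hFM s hsa'
  have hstar : ∀ θ, star (F θ + Complex.I • (s * G θ)) = F θ - Complex.I • (s * G θ) := by
    intro θ
    rw [star_add, star_smul, star_mul, hFs, hGs, hsst, hGsc]; simp [sub_eq_add_neg]
  have hsq : ∀ θ, (s * G θ) * (s * G θ) = G θ * G θ := fun θ => by
    rw [mul_assoc, ← mul_assoc (G θ), hGsc, mul_assoc, ← mul_assoc s, hss, one_mul]
  have hFsG : ∀ θ, F θ * (s * G θ) = (s * G θ) * F θ := fun θ => by
    rw [← mul_assoc, hFsc, mul_assoc, hFG, mul_assoc]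
  refine ⟨fun θ => F θ + Complex.I • (s * G θ), ?_, ?_, ?_, ?_, ?_, ?_⟩
  · have hb : ∀ x, |Real.arccos x| ≤ Real.pi := fun x => by
      rw [abs_of_nonneg (Real.arccos_nonneg x)]; exact Real.arccos_le_pi x
    have cF : Continuous F := cfc_cont a Real.arccos Real.cos
      (fun x y => Real.abs_cos_sub_cos_le x y)
      Real.continuous_arccos _ hb
    have cG : Continuous G := cfc_cont a Real.arccos Real.sin
      (fun x y => Real.abs_sin_sub_sin_le x y)
      Real.continuous_arccos _ hb
    fun_prop
  · intro θ
    refine mem_of_comm M _ fun y hy => ?_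
    rw [mul_add, add_mul, hFM y (hya y hy), mul_smul_comm, smul_mul_assoc, ← mul_assoc, hsM y hy,
      mul_assoc, mul_assoc, hGM y (hya y hy)]
  · intro θ
    rw [hstar]
    constructor
    · rw [mul_add, sub_mul, sub_mul, smul_mul_smul_comm, hsq, Complex.I_mul_I, mul_smul_comm,
        smul_mul_assoc, hFsG, ← hFFGG θ]
      module
    · rw [mul_sub, add_mul, add_mul, smul_mul_smul_comm, hsq, Complex.I_mul_I, mul_smul_comm,
        smul_mul_assoc, hFsG, ← hFFGG θ]
      module
  · simp [hF0, hG0]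
  · show F 1 + Complex.I • (s * G 1) = w
    rw [hF1, ← mul_smul_comm, ← hk, hsk, hac]
  · intro θ hθ
    let r : ℝ → ℝ := fun x => Real.sqrt (2 * (Real.cos (θ * Real.arccos x) - x))
    have hr : Continuous r := by
      have := hfc θ
      fun_prop
    refine ⟨cfc r a, ?_⟩
    have hd : star (cfc r a) = cfc r a := (cfc_predicate _ a : IsSelfAdjoint _).star_eq
    rw [hstar, hd, ← cfc_mul r r a hr.continuousOn hr.continuousOn]
    have : cfc (fun x => r x * r x) a = (2:ℝ) • (F θ - a) := by
      have e : F θ - a = cfc (fun x => Real.cos (θ * Real.arccos x) - x) a := by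
        rw [cfc_sub (fun x => Real.cos (θ * Real.arccos x)) (fun x => x) a (hfc θ).continuousOn
          continuousOn_id, cfc_id' ℝ a]
      rw [e, ← cfc_smul (2:ℝ) (fun x => Real.cos (θ * Real.arccos x) - x) a ((hfc θ).sub continuous_id).continuousOn]
      refine cfc_congr fun x hx => ?_
      have hle : x ≤ Real.cos (θ * Real.arccos x) := by
        conv_lhs => rw [← Real.cos_arccos (hspec x hx).1 (hspec x hx).2]
        have h0 := Real.arccos_nonneg x
        exact Real.cos_le_cos_of_nonneg_of_le_pi (mul_nonneg hθ.1 h0) (Real.arccos_le_pi x)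
          (mul_le_of_le_one_left h0 hθ.2)
      simp only [r, smul_eq_mul]
      exact Real.mul_self_sqrt (by linarith)
    rw [this, hww, two_smul, two_mul]
    beta_reduce
    generalize Complex.I • (s * G θ) = q
    abel

/-- positivity form -/
noncomputable def Q (φ : (H →L[ℂ] H) →ₗ[ℂ] ℂ) (x : H →L[ℂ] H) : ℝ :=
  (φ (star x * x)).re + (φ (x * star x)).re

lemma Q_nonneg (φ : (H →L[ℂ] H) →ₗ[ℂ] ℂ)
    (hφpos : ∀ x, 0 ≤ (φ (star x * x)).re ∧ (φ (star x * x)).im = 0)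
    (x) : 0 ≤ Q φ x := by
  have h1 := (hφpos x).1
  have h2 := (hφpos (star x)).1
  rw [star_star] at h2
  exact add_nonneg h1 h2

lemma Q_three (φ : (H →L[ℂ] H) →ₗ[ℂ] ℂ)
    (hφpos : ∀ x, 0 ≤ (φ (star x * x)).re ∧ (φ (star x * x)).im = 0)
    (x y z) : Q φ (x + y + z) ≤ 3 * (Q φ x + Q φ y + Q φ z) := by
  have h1 := Q_nonneg φ hφpos (x - y)
  have h2 := Q_nonneg φ hφpos (y - z)
  have h3 := Q_nonneg φ hφpos (x - z)
  simp only [Q, star_add, star_sub, mul_add, mul_sub, add_mul, sub_mul, map_add, map_sub,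
    Complex.add_re, Complex.sub_re] at *
  linarith

lemma Q_le_eight (φ : (H →L[ℂ] H) →ₗ[ℂ] ℂ)
    (hφpos : ∀ x, 0 ≤ (φ (star x * x)).re ∧ (φ (star x * x)).im = 0)
    (hφ1 : φ 1 = 1) (x y : H →L[ℂ] H) (hx : star x * x = 1 ∧ x * star x = 1)
    (hy : star y * y = 1 ∧ y * star y = 1) : Q φ (x - y) ≤ 8 := by
  have h1 := Q_nonneg φ hφpos (x + y)
  simp only [Q, star_add, star_sub, mul_add, mul_sub, add_mul, sub_mul, map_add, map_sub,
    Complex.add_re, Complex.sub_re, hx.1, hx.2, hy.1, hy.2, hφ1, Complex.one_re] at *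
  linarith

lemma Q_arc (φ : (H →L[ℂ] H) →ₗ[ℂ] ℂ)
    (hφpos : ∀ x, 0 ≤ (φ (star x * x)).re ∧ (φ (star x * x)).im = 0)
    (v w W d : H →L[ℂ] H) (hv : star v * v = 1)
    (hw : star w * w = 1 ∧ w * star w = 1) (hW : star W * W = 1 ∧ W * star W = 1)
    (hd : w + star w + star d * d = W + star W) : Q φ (v * W - v) ≤ Q φ (v - v * w) := by
  have e1 : star (v * W - v) * (v * W - v) + star d * d = star (v - v * w) * (v - v * w) := by
    have : star d * d = W + star W - w - star w := by rw [← hd]; abel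
    rw [this]
    simp only [← mul_sub_one v W, ← mul_one_sub v w, star_mul]
    rw [mul_assoc, ← mul_assoc (star v), hv, mul_assoc, ← mul_assoc (star v), hv]
    simp only [star_sub, star_one, mul_sub, sub_mul, one_mul, mul_one, hw.1, hW.1]
    abel
  have e2 : (v * W - v) * star (v * W - v) + star (d * star v) * (d * star v)
      = (v - v * w) * star (v - v * w) := by
    have : star d * d = W + star W - w - star w := by rw [← hd]; abel
    rw [star_mul, star_star, mul_assoc v (star d), ← mul_assoc (star d), this]
    simp only [← mul_sub_one v W, ← mul_one_sub v w, star_mul]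
    rw [mul_assoc v, mul_assoc v, ← mul_assoc (W - 1), ← mul_assoc (1 - w), ← mul_add, ← add_mul]
    congr 2
    simp only [star_sub, star_one, mul_sub, sub_mul, one_mul, mul_one, hw.2, hW.2]
    abel
  have p1 := (hφpos d).1
  have p2 := (hφpos (d * star v)).1
  simp only [Q]
  rw [← e1, ← e2, map_add, map_add, Complex.add_re, Complex.add_re]
  linarith

lemma glue (M : VonNeumannAlgebra H) [Nontrivial (H →L[ℂ] H)] (φ : (H →L[ℂ] H) →ₗ[ℂ] ℂ)
    (hφpos : ∀ x, 0 ≤ (φ (star x * x)).re ∧ (φ (star x * x)).im = 0) (n : ℕ) :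
    ∀ (t : Fin (n + 1) → ℝ) (_ : StrictMono t)
    (u : Fin (n + 1) → H →L[ℂ] H)
    (_ : ∀ j, u j ∈ M)
    (_ : ∀ j, star (u j) * u j = 1 ∧ u j * star (u j) = 1),
    ∃ U : ℝ → H →L[ℂ] H,
      (∀ s, U s ∈ M) ∧
      (∀ s, star (U s) * U s = 1 ∧ U s * star (U s) = 1) ∧
      Continuous U ∧
      (∀ j, U (t j) = u j) ∧
      (∀ s, t (Fin.last n) ≤ s → U s = u (Fin.last n)) ∧
      (∀ j : Fin n, ∀ s ∈ Set.Icc (t j.castSucc) (t j.succ),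
        Q φ (U s - u j.castSucc) ≤ Q φ (u j.castSucc - u j.succ)) := by
  induction n with
  | zero =>
    intro t ht u huM huU
    refine ⟨fun _ => u 0, fun _ => huM 0, fun _ => huU 0, continuous_const, ?_, ?_, ?_⟩
    · intro j; exact congrArg u (Fin.fin_one_eq_zero j).symm
    · intro s _; rfl
    · intro j; exact j.elim0
  | succ n ih =>
    intro t ht u huM huU
    obtain ⟨U, hM, hU, hc, hj, hl, hQ⟩ := ih (fun j => t j.castSucc)
      (ht.comp (Fin.strictMono_castSucc)) (fun j => u j.castSucc) (fun j => huM _) (fun j => huU _)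
    obtain ⟨v, hv⟩ : ∃ v, v = u (Fin.last n).castSucc := ⟨_, rfl⟩
    obtain ⟨z, hz⟩ : ∃ z, z = u (Fin.last (n+1)) := ⟨_, rfl⟩
    have hvU : star v * v = 1 ∧ v * star v = 1 := hv ▸ huU _
    have hzU : star z * z = 1 ∧ z * star z = 1 := hz ▸ huU _
    have hvM : v ∈ M := hv ▸ huM _
    have hzM : z ∈ M := hz ▸ huM _
    have hw1 : star (star v * z) * (star v * z) = 1 := by
      rw [star_mul, star_star, mul_assoc, ← mul_assoc v, hvU.2, one_mul, hzU.1]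
    have hw2 : (star v * z) * star (star v * z) = 1 := by
      rw [star_mul, star_star, mul_assoc, ← mul_assoc z, hzU.2, one_mul, hvU.1]
    have hvz : v * (star v * z) = z := by rw [← mul_assoc, hvU.2, one_mul]
    obtain ⟨W, Wc, WM, WU, W0, W1, Wd⟩ := unitary_arc M (star v * z)
      (mul_mem (star_mem hvM) hzM) hw1 hw2
    obtain ⟨α, hα⟩ : ∃ α, α = t (Fin.last n).castSucc := ⟨_, rfl⟩
    obtain ⟨β, hβ⟩ : ∃ β, β = t (Fin.last (n+1)) := ⟨_, rfl⟩
    have hαβ : α < β := by rw [hα, hβ]; exact ht (Fin.castSucc_lt_last _)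
    let τ : ℝ → ℝ := fun s => max 0 (min 1 ((s - α) / (β - α)))
    have hτc : Continuous τ := by fun_prop
    have hτ0 : ∀ s ≤ α, τ s = 0 := fun s hs => by
      apply max_eq_left
      exact (min_le_right _ _).trans (div_nonpos_of_nonpos_of_nonneg (by linarith) (by linarith))
    have hτ1 : ∀ s, β ≤ s → τ s = 1 := fun s hs => by
      have : 1 ≤ (s - α) / (β - α) := by rw [le_div_iff₀ (by linarith)]; linarith
      simp [τ, min_eq_left this]
    have hτI : ∀ s, τ s ∈ Set.Icc (0:ℝ) 1 := fun s =>
      ⟨le_max_left _ _, max_le zero_le_one (min_le_left _ _)⟩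
    have hlo : ∀ s ≤ α, U s * W (τ s) = U s := fun s hs => by rw [hτ0 s hs, W0, mul_one]
    have hhi : ∀ s, α ≤ s → U s * W (τ s) = v * W (τ s) := fun s hs => by
      rw [hl s (by rwa [← hα]), hv]
    have hend : ∀ s, β ≤ s → U s * W (τ s) = z := fun s hs => by
      rw [hhi s (by linarith), hτ1 s hs, W1, hvz]
    refine ⟨fun s => U s * W (τ s), fun s => mul_mem (hM s) (WM _), ?_, ?_, ?_, ?_, ?_⟩
    · intro s
      rw [star_mul]
      constructor
      · rw [mul_assoc, ← mul_assoc (star (U s)), (hU s).1, one_mul, (WU _).1]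
      · rw [mul_assoc, ← mul_assoc (W _), (WU _).2, one_mul, (hU s).2]
    · exact hc.mul (Wc.comp hτc)
    · intro j
      refine Fin.lastCases ?_ (fun i => ?_) j
      · rw [← hz]; exact hend _ hβ.le
      · show U (t i.castSucc) * W _ = _
        rw [hlo, hj]
        rw [hα]; exact ht.monotone (Fin.castSucc_le_castSucc_iff.2 (Fin.le_last i))
    · intro s hs
      rw [← hz]; exact hend s (by rwa [hβ])
    · intro j s hs
      revert hs
      refine Fin.lastCases (fun hs => ?_) (fun i hs => ?_) j
      · rw [Fin.succ_last, ← hα] at hs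
        show Q φ (U s * W (τ s) - _) ≤ _
        rw [hhi s hs.1, Fin.succ_last, ← hv, ← hz]
        obtain ⟨d, hd⟩ := Wd (τ s) (hτI s)
        have := Q_arc φ hφpos v (star v * z) (W (τ s)) d hvU.1 ⟨hw1, hw2⟩ (WU _) hd
        rwa [hvz] at this
      · rw [Fin.succ_castSucc] at hs ⊢
        show Q φ (U s * W (τ s) - _) ≤ _
        rw [hlo s]
        · exact hQ i s hs
        · rw [hα]
          exact hs.2.trans (ht.monotone (Fin.castSucc_le_castSucc_iff.2 (Fin.le_last _)))

lemma exists_segment (n : ℕ) (t : Fin (n + 1) → ℝ) (s : ℝ)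
    (hs : s ∈ Set.Icc (t 0) (t (Fin.last n))) :
    s = t (Fin.last n) ∨ ∃ j : Fin n, s ∈ Set.Icc (t j.castSucc) (t j.succ) := by
  induction n with
  | zero => left; exact le_antisymm hs.2 hs.1
  | succ n ih =>
    right
    rcases le_total s (t (Fin.last n).castSucc) with h | h
    · rcases ih (fun j => t j.castSucc) ⟨hs.1, h⟩ with h' | ⟨j, hj⟩
      · exact ⟨Fin.last n, h'.ge, by simpa using hs.2⟩
      · exact ⟨j.castSucc, hj⟩
    · exact ⟨Fin.last n, h, by simpa using hs.2⟩

/- STATEMENT 3: Given unitaries u₁, …, u_{n+1} in a von Neumann algebra M with a faithful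
(normal) state φ and ‖u_j − u_{j+1}‖_φ^♯ < ε for consecutive indices, there is a strongly
continuous path of unitaries in M through the u_j's with ‖u(t) − u_j‖_φ^♯ < √2 ε^{1/2} on
[t_j, t_{j+1}]; if moreover all mutual distances are < ε then ‖u(s) − u(t)‖_φ^♯ < 4 ε^{1/2}. -/
theorem unitary_path_through_unitaries
    (M : VonNeumannAlgebra H) (φ : (H →L[ℂ] H) →ₗ[ℂ] ℂ)
    (hφ1 : φ 1 = 1)
    (hφpos : ∀ x, 0 ≤ (φ (star x * x)).re ∧ (φ (star x * x)).im = 0)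
    (hφfaithful : ∀ x ∈ M, φ (star x * x) = 0 → x = 0)
    (n : ℕ) (t : Fin (n + 1) → ℝ) (ht : StrictMono t)
    (u : Fin (n + 1) → H →L[ℂ] H)
    (huM : ∀ j, u j ∈ M)
    (huU : ∀ j, star (u j) * u j = 1 ∧ u j * star (u j) = 1)
    (ε : ℝ) (hε : 0 < ε)
    (hclose : ∀ j : Fin n, sharpNorm φ (u j.castSucc - u j.succ) < ε) :
    ∃ U : ℝ → H →L[ℂ] H,
      (∀ s, U s ∈ M) ∧
      (∀ s, star (U s) * U s = 1 ∧ U s * star (U s) = 1) ∧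
      (∀ ξ : H, ContinuousOn (fun s => U s ξ) (Set.Icc (t 0) (t (Fin.last n)))) ∧
      (∀ j, U (t j) = u j) ∧
      (∀ j : Fin n, ∀ s ∈ Set.Icc (t j.castSucc) (t j.succ),
        sharpNorm φ (U s - u j.castSucc) < Real.sqrt 2 * Real.sqrt ε) ∧
      ((∀ i j, sharpNorm φ (u i - u j) < ε) →
        ∀ s ∈ Set.Icc (t 0) (t (Fin.last n)), ∀ s' ∈ Set.Icc (t 0) (t (Fin.last n)),
          sharpNorm φ (U s - U s') < 4 * Real.sqrt ε) := by
  have hne : Nontrivial (H →L[ℂ] H) := ⟨1, 0, fun h => by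
    rw [h, map_zero] at hφ1; exact zero_ne_one hφ1⟩
  obtain ⟨U, hM, hU, hc, hj, -, hQ⟩ := glue M φ hφpos n t ht u huM huU
  have hsh : ∀ x r, 0 < r → (sharpNorm φ x < r ↔ Q φ x < 2 * r ^ 2) := fun x r hr => by
    rw [sharpNorm, Real.sqrt_lt' hr]
    change Q φ x / 2 < r ^ 2 ↔ _
    constructor <;> intro h <;> linarith
  have hsε : 0 < Real.sqrt ε := Real.sqrt_pos.2 hε
  have hsε2 : Real.sqrt ε ^ 2 = ε := Real.sq_sqrt hε.le
  have hs2 : Real.sqrt 2 ^ 2 = 2 := Real.sq_sqrt zero_le_two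
  have hseg : ∀ j : Fin n, ∀ s ∈ Set.Icc (t j.castSucc) (t j.succ),
      Q φ (U s - u j.castSucc) < 2 * ε ^ 2 := fun j s hs =>
    (hQ j s hs).trans_lt ((hsh _ _ hε).1 (hclose j))
  refine ⟨U, hM, hU, fun ξ => ?_, hj, ?_, ?_⟩
  · exact (hc.clm_apply continuous_const).continuousOn
  · intro j s hs
    rw [hsh _ _ (by positivity), mul_pow, hsε2, hs2]
    have h1 := hseg j s hs
    have h2 := Q_le_eight φ hφpos hφ1 (U s) (u j.castSucc) (hU s) (huU _)
    rcases le_or_gt ε 2 with h | h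
    · nlinarith
    · linarith
  · intro hall s hs s' hs'
    have hnear : ∀ s ∈ Set.Icc (t 0) (t (Fin.last n)), ∃ j, Q φ (U s - u j) < 2 * ε ^ 2 := by
      intro s hs
      rcases exists_segment n t s hs with h | ⟨j, h⟩
      · refine ⟨Fin.last n, ?_⟩
        rw [h, hj, sub_self]
        simp only [Q, mul_zero, star_zero, map_zero, Complex.zero_re, add_zero]
        positivity
      · exact ⟨_, hseg j s h⟩
    obtain ⟨i, hi⟩ := hnear s hs
    obtain ⟨k, hk⟩ := hnear s' hs'
    have hik := (hsh _ _ hε).1 (hall i k)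
    rw [hsh _ _ (by positivity), mul_pow, hsε2]
    have h8 := Q_le_eight φ hφpos hφ1 (U s) (U s') (hU s) (hU s')
    have h3 := Q_three φ hφpos (U s - u i) (u i - u k) (u k - U s')
    have hneg : Q φ (u k - U s') = Q φ (U s' - u k) := by
      rw [← neg_sub (U s') (u k)]; simp only [Q, star_neg, neg_mul_neg]
    rw [hneg, show U s - u i + (u i - u k) + (u k - U s') = U s - U s' by abel] at h3
    rcases le_or_gt ε (1/4) with h | h
    · nlinarith
    · linarith

end Stmt3
end

section
/- Let M be a finite von Neumann algebra with a normal tracial state τ and let a ∈ M satisfy ‖a*a − 1‖_τ < δ, where ‖x‖_τ = τ(x*x)^{1/2}. Then there exists a unitary v ∈ M with ‖a − v‖_τ < (3 + ‖a‖) δ. -/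
theorem aux_mul_apply {H : Type*} [NormedAddCommGroup H] [InnerProductSpace ℂ H]
    (s t : H →L[ℂ] H) (x : H) : (s * t) x = s (t x) := rfl

theorem aux_smul_comp {H K : Type*} [NormedAddCommGroup H] [InnerProductSpace ℂ H]
    [NormedAddCommGroup K] [InnerProductSpace ℂ K] (r : ℂ)
    (s : K →L[ℂ] H) (t : H →L[ℂ] K) (x : H) : (r • (s ∘L t)) x = r • s (t x) := rfl

open ContinuousLinearMap in
theorem aux_abs_norm {H : Type*} [NormedAddCommGroup H] [InnerProductSpace ℂ H] [CompleteSpace H]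
    (s : H →L[ℂ] H) (x : H) : ‖CFC.abs s x‖ = ‖s x‖ := by
  have hsa : star (CFC.abs s) = CFC.abs s := (IsSelfAdjoint.of_nonneg (CFC.abs_nonneg s)).star_eq
  have h1 : star (CFC.abs s) * CFC.abs s = star s * s := by rw [hsa]; exact CFC.abs_mul_abs s
  have key : ∀ t : H →L[ℂ] H, inner ℂ (t x) (t x) = inner ℂ x ((star t * t) x) := by
    intro t
    rw [star_eq_adjoint, aux_mul_apply, adjoint_inner_right]
  have h2 : inner ℂ (CFC.abs s x) (CFC.abs s x) = inner ℂ (s x) (s x) := by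
    rw [key, key, h1]
  rw [inner_self_eq_norm_sq_to_K, inner_self_eq_norm_sq_to_K] at h2
  have h3 : ‖CFC.abs s x‖ ^ 2 = ‖s x‖ ^ 2 := by exact_mod_cast h2
  exact (sq_eq_sq₀ (norm_nonneg _) (norm_nonneg _)).1 h3

/-- Graphs of isometries intertwining the commutant. -/
def AuxGood {H : Type*} [NormedAddCommGroup H] [InnerProductSpace ℂ H] [CompleteSpace H]
    (M : VonNeumannAlgebra H) (G : Submodule ℂ (WithLp 2 (H × H))) : Prop :=
  (∀ z ∈ G, ‖z.fst‖ = ‖z.snd‖) ∧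
    ∀ c ∈ M.commutant, ∀ z ∈ G, WithLp.toLp 2 (c z.fst, c z.snd) ∈ G

theorem aux_mem_of_commute {H : Type*} [NormedAddCommGroup H] [InnerProductSpace ℂ H]
    [CompleteSpace H] (M : VonNeumannAlgebra H) (w : H →L[ℂ] H)
    (h : ∀ c ∈ M.commutant, c * w = w * c) : w ∈ M := by
  rw [← M.commutant_commutant, VonNeumannAlgebra.mem_commutant_iff]
  exact h

theorem aux_comm {H : Type*} [NormedAddCommGroup H] [InnerProductSpace ℂ H]
    [CompleteSpace H] {M : VonNeumannAlgebra H} {w c : H →L[ℂ] H}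
    (hw : w ∈ M) (hc : c ∈ M.commutant) (x : H) : c (w x) = w (c x) := by
  have := VonNeumannAlgebra.mem_commutant_iff.1 hc w hw
  exact (DFunLike.congr_fun this x).symm

theorem aux_abs_mem {H : Type*} [NormedAddCommGroup H] [InnerProductSpace ℂ H]
    [CompleteSpace H] {M : VonNeumannAlgebra H} {s : H →L[ℂ] H}
    (hs : s ∈ M) : CFC.abs s ∈ M := by
  apply aux_mem_of_commute
  intro c hc
  have h1 := VonNeumannAlgebra.mem_commutant_iff.1 hc s hs
  have h2 := VonNeumannAlgebra.mem_commutant_iff.1 (star_mem hc) s hs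
  have h3 : Commute s c := h1
  have h4 : Commute s (star c) := h2
  exact (Commute.cfcAbs_left (a := s) (b := c) h3 h4).symm

/-- graph of `(|s|, s)`. -/
noncomputable def auxGraph {H : Type*} [NormedAddCommGroup H] [InnerProductSpace ℂ H] [CompleteSpace H]
    (s : H →L[ℂ] H) : H →ₗ[ℂ] WithLp 2 (H × H) where
  toFun x := WithLp.toLp 2 (CFC.abs s x, s x)
  map_add' x y := by simp [← WithLp.toLp_add]
  map_smul' r x := by simp [← WithLp.toLp_smul]

theorem aux_graph_good {H : Type*} [NormedAddCommGroup H] [InnerProductSpace ℂ H] [CompleteSpace H]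
    (M : VonNeumannAlgebra H) (s : H →L[ℂ] H) (hs : s ∈ M) :
    AuxGood M (LinearMap.range (auxGraph s)) := by
  constructor
  · rintro _ ⟨x, rfl⟩
    exact aux_abs_norm s x
  · rintro c hc _ ⟨x, rfl⟩
    refine ⟨c x, ?_⟩
    change WithLp.toLp 2 (CFC.abs s (c x), s (c x)) = WithLp.toLp 2 (c (CFC.abs s x), c (s x))
    rw [aux_comm hs hc, aux_comm (aux_abs_mem hs) hc]

theorem aux_zorn {H : Type*} [NormedAddCommGroup H] [InnerProductSpace ℂ H] [CompleteSpace H]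
    (M : VonNeumannAlgebra H) (G₀ : Submodule ℂ (WithLp 2 (H × H))) (h₀ : AuxGood M G₀) :
    ∃ G, G₀ ≤ G ∧ Maximal (AuxGood M) G := by
  refine zorn_le_nonempty₀ {G | AuxGood M G} ?_ G₀ h₀
  intro c hc hch y hy
  refine ⟨sSup c, ⟨?_, ?_⟩, fun z hz => le_sSup hz⟩
  · intro z hz
    obtain ⟨G, hG, hzG⟩ := (Submodule.mem_sSup_of_directed ⟨y, hy⟩ hch.directedOn).1 hz
    exact (hc hG).1 z hzG
  · intro t ht z hz
    obtain ⟨G, hG, hzG⟩ := (Submodule.mem_sSup_of_directed ⟨y, hy⟩ hch.directedOn).1 hz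
    exact (le_sSup hG : G ≤ sSup c) ((hc hG).2 t ht z hzG)

theorem aux_closed {H : Type*} [NormedAddCommGroup H] [InnerProductSpace ℂ H] [CompleteSpace H]
    (M : VonNeumannAlgebra H) (G : Submodule ℂ (WithLp 2 (H × H))) (h : Maximal (AuxGood M) G) :
    IsClosed (G : Set (WithLp 2 (H × H))) := by
  have hg : AuxGood M G.topologicalClosure := by
    constructor
    · intro z hz
      have hcl : IsClosed {z : WithLp 2 (H × H) | ‖z.fst‖ = ‖z.snd‖} :=
        isClosed_eq (by fun_prop) (by fun_prop)
      exact (closure_minimal (fun z hz => h.1.1 z hz) hcl) hz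
    · intro c hc z hz
      have hcont : Continuous (fun z : WithLp 2 (H × H) => WithLp.toLp 2 (c z.fst, c z.snd)) := by
        fun_prop
      exact map_mem_closure (f := fun z : WithLp 2 (H × H) => WithLp.toLp 2 (c z.fst, c z.snd))
        hcont hz (fun z hz => h.1.2 c hc z hz)
  have := h.2 hg G.le_topologicalClosure
  have h2 : G.topologicalClosure = G := le_antisymm this G.le_topologicalClosure
  rw [← h2]
  exact G.isClosed_topologicalClosure

open ContinuousLinearMap in
theorem aux_partial_isometry {H : Type*} [NormedAddCommGroup H] [InnerProductSpace ℂ H]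
    [CompleteSpace H]
    (M : VonNeumannAlgebra H) (G : Submodule ℂ (WithLp 2 (H × H))) (h : AuxGood M G)
    (hcl : IsClosed (G : Set (WithLp 2 (H × H)))) :
    ∃ w ∈ M, w * star w * w = w ∧ ∀ z ∈ G, w z.fst = z.snd ∧ star w z.snd = z.fst := by
  have : CompleteSpace G := hcl.completeSpace_coe
  let p : G →L[ℂ] H := (WithLp.fstL 2 ℂ H H).comp G.subtypeL
  let q : G →L[ℂ] H := (WithLp.sndL 2 ℂ H H).comp G.subtypeL
  have hn : ∀ g : G, ‖p g‖ = ‖q g‖ := fun g => h.1 g g.2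
  have hpq : adjoint p ∘L p = adjoint q ∘L q := by
    refine ContinuousLinearMap.ext fun g => ext_inner_left ℂ fun g' => ?_
    simp only [comp_apply, adjoint_inner_right]
    rw [inner_eq_sum_norm_sq_div_four, inner_eq_sum_norm_sq_div_four (q g') (q g)]
    simp only [← map_add, ← map_sub, ← map_smul, hn]
  have hsum : adjoint p ∘L p + adjoint q ∘L q = ContinuousLinearMap.id ℂ G := by
    refine ContinuousLinearMap.ext fun g => ext_inner_left ℂ fun g' => ?_
    simp only [comp_apply, adjoint_inner_right, add_apply, inner_add_right, id_apply]
    rw [Submodule.coe_inner, WithLp.prod_inner_apply]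
    rfl
  have hp2 : (2:ℂ) • (adjoint p ∘L p) = ContinuousLinearMap.id ℂ G := by
    rw [← hsum, ← hpq, two_smul]
  have hq2 : (2:ℂ) • (adjoint q ∘L q) = ContinuousLinearMap.id ℂ G := by
    rw [← hsum, hpq, two_smul]
  have hp2' : ∀ g, (2:ℂ) • adjoint p (p g) = g := fun g => DFunLike.congr_fun hp2 g
  have hq2' : ∀ g, (2:ℂ) • adjoint q (q g) = g := fun g => DFunLike.congr_fun hq2 g
  let w : H →L[ℂ] H := (2:ℂ) • (q ∘L adjoint p)
  have hws : star w = (2:ℂ) • (p ∘L adjoint q) := by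
    rw [star_eq_adjoint]
    change adjoint ((2:ℂ) • (q ∘L adjoint p)) = _
    rw [map_smulₛₗ, adjoint_comp, adjoint_adjoint, map_ofNat]
  have hw1 : ∀ g, w (p g) = q g := by
    intro g
    change (2:ℂ) • q (adjoint p (p g)) = q g
    rw [← map_smul, hp2']
  have hw2 : ∀ g, star w (q g) = p g := by
    intro g
    rw [hws]
    rw [aux_smul_comp]
    rw [← map_smul, hq2']
  have hwx : ∀ x, w x = q ((2:ℂ) • adjoint p x) := by
    intro x; rw [map_smul]; rfl
  refine ⟨w, ?_, ?_, fun z hz => ⟨hw1 ⟨z, hz⟩, hw2 ⟨z, hz⟩⟩⟩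
  · apply aux_mem_of_commute
    intro c hc
    refine ContinuousLinearMap.ext fun x => ?_
    simp only [aux_mul_apply]
    -- decomposition
    set g : G := (2:ℂ) • adjoint p x with hg
    set k := x - p g with hk
    have hpk : adjoint p k = 0 := by
      have : (2:ℂ) • adjoint p k = 0 := by
        rw [hk, map_sub, smul_sub, hp2', hg, sub_self]
      simpa using this
    have hx : x = p g + k := by simp [hk]
    have hck : adjoint p (c k) = 0 := by
      refine ext_inner_left ℂ fun g' => ?_
      rw [adjoint_inner_right, inner_zero_right, ← adjoint_inner_left, ← star_eq_adjoint]
      have h3 := h.2 (star c) (star_mem hc) g' g'.2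
      have h4 : star c (p g') = p ⟨_, h3⟩ := rfl
      rw [h4, ← adjoint_inner_right, hpk, inner_zero_right]
    have h5 : c (p g) = p ⟨_, h.2 c hc g g.2⟩ := rfl
    have h6 : c (q g) = q ⟨_, h.2 c hc g g.2⟩ := rfl
    have h7 : w k = 0 := by rw [hwx, hpk]; simp
    have h8 : w (c k) = 0 := by rw [hwx, hck]; simp
    rw [hx, map_add, map_add, map_add, map_add, h7, h8, map_zero, add_zero, add_zero, hw1, h5, hw1, h6]
  · refine ContinuousLinearMap.ext fun x => ?_
    simp only [aux_mul_apply]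
    rw [hwx x, hw2, hw1]

open ContinuousLinearMap in
theorem aux_maximal {H : Type*} [NormedAddCommGroup H] [InnerProductSpace ℂ H]
    [CompleteSpace H]
    (M : VonNeumannAlgebra H) (G : Submodule ℂ (WithLp 2 (H × H))) (h : Maximal (AuxGood M) G)
    (w : H →L[ℂ] H) (hw : ∀ z ∈ G, w z.fst = z.snd ∧ star w z.snd = z.fst)
    (s : H →L[ℂ] H) (hs : s ∈ M) (hse : s * (star w * w) = 0) (hfs : (w * star w) * s = 0) :
    s = 0 := by
  have hgs := aux_graph_good M s hs
  have o1 : ∀ z ∈ G, ∀ x, inner ℂ z.fst (CFC.abs s x) = 0 := by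
    intro z hz x
    have hsa : adjoint (CFC.abs s) = CFC.abs s :=
      (IsSelfAdjoint.of_nonneg (CFC.abs_nonneg s)).star_eq
    have e1 : CFC.abs s z.fst = 0 := by
      rw [← norm_eq_zero, aux_abs_norm, norm_eq_zero]
      have := DFunLike.congr_fun hse z.fst
      simpa [aux_mul_apply, (hw z hz).1, (hw z hz).2] using this
    rw [← adjoint_inner_left, hsa, e1, inner_zero_left]
  have o2 : ∀ z ∈ G, ∀ x, inner ℂ z.snd (s x) = 0 := by
    intro z hz x
    have e1 : z.snd = star (w * star w) z.snd := by
      simp [aux_mul_apply, (hw z hz).1, (hw z hz).2]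
    rw [e1, star_eq_adjoint, adjoint_inner_left, ← aux_mul_apply, hfs]
    simp
  have hgood : AuxGood M (G ⊔ LinearMap.range (auxGraph s)) := by
    constructor
    · intro z hz
      obtain ⟨y, hy, _, ⟨x, rfl⟩, rfl⟩ := Submodule.mem_sup.1 hz
      have a1 := norm_add_sq_eq_norm_sq_add_norm_sq_of_inner_eq_zero (𝕜 := ℂ) _ _ (o1 y hy x)
      have a2 := norm_add_sq_eq_norm_sq_add_norm_sq_of_inner_eq_zero (𝕜 := ℂ) _ _ (o2 y hy x)
      rw [aux_abs_norm, h.1.1 y hy, ← a2] at a1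
      exact (mul_self_inj (norm_nonneg _) (norm_nonneg _)).1 a1
    · intro c hc z hz
      obtain ⟨y, hy, t, ht, rfl⟩ := Submodule.mem_sup.1 hz
      refine Submodule.mem_sup.2 ⟨_, h.1.2 c hc y hy, _, hgs.2 c hc t ht, ?_⟩
      simp [← WithLp.toLp_add]
  have hle : LinearMap.range (auxGraph s) ≤ G := le_sup_right.trans (h.2 hgood le_sup_left)
  refine ContinuousLinearMap.ext fun x => ?_
  have := o2 _ (hle ⟨x, rfl⟩) x
  exact inner_self_eq_zero.1 this

open ContinuousLinearMap in
theorem aux_isometry {H : Type*} [NormedAddCommGroup H] [InnerProductSpace ℂ H]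
    [CompleteSpace H] (M : VonNeumannAlgebra H)
    (hfin : ∀ v ∈ M, star v * v = 1 → v * star v = 1)
    (w : H →L[ℂ] H) (hw : w ∈ M) (hpi : w * star w * w = w)
    (hmax : ∀ s ∈ M, s * (star w * w) = 0 → (w * star w) * s = 0 → s = 0) :
    star w * w = 1 := by
  have hpi' : star w * w * star w = star w := by
    have := congrArg star hpi
    simpa [mul_assoc] using this
  have hws := star_mem hw
  have hzero : ∀ t ∈ M, (1 - w * star w) * t * (1 - star w * w) = 0 := by
    intro t ht
    apply hmax
    · exact mul_mem (mul_mem (sub_mem (one_mem M) (mul_mem hw hws)) ht)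
        (sub_mem (one_mem M) (mul_mem hws hw))
    · rw [mul_assoc, sub_mul 1 (star w * w), one_mul, ← mul_assoc (star w * w), hpi', sub_self, mul_zero]
    · rw [← mul_assoc, ← mul_assoc, mul_sub (w * star w) 1, mul_one, ← mul_assoc (w * star w), hpi, sub_self,
        zero_mul, zero_mul]
  let S : Set H := {y | ∃ t ∈ M, ∃ x, y = t ((1 - star w * w) x)}
  let K : Submodule ℂ H := (Submodule.span ℂ S).topologicalClosure
  have : CompleteSpace K := (Submodule.isClosed_topologicalClosure _).completeSpace_coe
  have hinv : ∀ c : H →L[ℂ] H, (∀ y ∈ S, c y ∈ S) → ∀ y ∈ K, c y ∈ K := by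
    intro c hc y hy
    refine map_mem_closure c.continuous hy ?_
    intro y hy
    induction hy using Submodule.span_induction with
    | mem x h => exact Submodule.subset_span (hc x h)
    | zero => simp
    | add x y _ _ hx hy => rw [map_add]; exact add_mem hx hy
    | smul a x _ hx => rw [map_smul]; exact Submodule.smul_mem _ _ hx
  set z := K.starProjection with hz
  have hzp : IsStarProjection z := isStarProjection_starProjection
  have hzM : z ∈ M := by
    rw [VonNeumannAlgebra.IsStarProjection.mem_iff hzp]
    intro c hc
    rw [Submodule.range_starProjection]
    refine hinv c ?_
    rintro _ ⟨t, ht, x, rfl⟩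
    refine ⟨t, ht, c x, ?_⟩
    rw [aux_comm ht hc, aux_comm (sub_mem (one_mem M) (mul_mem hws hw)) hc]
  have hzM' : z ∈ M.commutant := by
    rw [VonNeumannAlgebra.IsStarProjection.mem_iff hzp, M.commutant_commutant]
    intro c hc
    rw [Submodule.range_starProjection]
    refine hinv c ?_
    rintro _ ⟨t, ht, x, rfl⟩
    exact ⟨c * t, mul_mem hc ht, x, rfl⟩
  have hzs : star z = z := hzp.isSelfAdjoint.star_eq
  have hzz : z * z = z := hzp.isIdempotentElem
  have hfz : w * star w * z = z := by
    refine ContinuousLinearMap.ext fun x => ?_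
    have hx : z x ∈ K := Submodule.starProjection_apply_mem _ _
    have hcl : IsClosed {y : H | (w * star w) y = y} := isClosed_eq (by fun_prop) (by fun_prop)
    refine closure_minimal (t := {y : H | (w * star w) y = y}) ?_ hcl hx
    intro y hy
    change (w * star w) y = y
    induction hy using Submodule.span_induction with
    | mem x h =>
      obtain ⟨t, ht, x, rfl⟩ := h
      have := DFunLike.congr_fun (hzero t ht) x
      rw [aux_mul_apply, aux_mul_apply, sub_apply] at this
      exact (sub_eq_zero.1 this).symm
    | zero => simp
    | add x y _ _ hx hy => rw [map_add, hx, hy]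
    | smul a x _ hx => rw [map_smul, hx]
  have hze : z * (1 - star w * w) = 1 - star w * w := by
    refine ContinuousLinearMap.ext fun x => ?_
    rw [aux_mul_apply]
    apply Submodule.starProjection_eq_self_iff.2
    exact subset_closure (Submodule.subset_span ⟨1, one_mem M, x, rfl⟩)
  have c1 : w * z = z * w := VonNeumannAlgebra.mem_commutant_iff.1 hzM' w hw
  have c2 : star w * z = z * star w := VonNeumannAlgebra.mem_commutant_iff.1 hzM' _ hws
  have hsv : star (star w * z + (1 - z)) = w * z + (1 - z) := by
    simp [hzs, c1]
  have hv := hfin (star w * z + (1 - z))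
    (add_mem (mul_mem hws hzM) (sub_mem (one_mem M) hzM)) (by
      rw [hsv]
      have : w * z * (star w * z) = z := by
        rw [mul_assoc, ← mul_assoc z, ← c2, mul_assoc (star w), hzz, ← mul_assoc, hfz]
      have e1 : w * z * (1 - z) = 0 := by rw [mul_assoc, mul_sub, mul_one, hzz, sub_self, mul_zero]
      have e2 : (1 - z) * (star w * z) = 0 := by
        rw [c2, ← mul_assoc, sub_mul, one_mul, hzz, sub_self, zero_mul]
      have e3 : (1 - z) * (1 - z) = 1 - z := by
        rw [mul_sub, mul_one, sub_mul, one_mul, hzz, sub_self, sub_zero]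
      rw [add_mul, mul_add, mul_add, this, e1, e2, e3]
      abel)
  rw [hsv] at hv
  have hv2 : star w * w * z = z := by
    have := congrArg (fun t => t * z) hv
    have e4 : (w * z + (1 - z)) * z = w * z := by
      rw [add_mul, mul_assoc, hzz, sub_mul, one_mul, hzz, sub_self, add_zero]
    have e5 : (star w * z + (1 - z)) * (w * z) = star w * w * z := by
      rw [c1, ← mul_assoc, add_mul, mul_assoc, hzz, sub_mul, one_mul, hzz, sub_self, add_zero, mul_assoc,
        ← c1, ← mul_assoc]
    simp only [mul_assoc _ _ z] at this
    rw [e4, e5, one_mul] at this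
    exact this
  have hfinal : (1 - star w * w) * z = 0 := by rw [sub_mul, one_mul, hv2, sub_self]
  have c3 : (1 - star w * w) * z = z * (1 - star w * w) :=
    VonNeumannAlgebra.mem_commutant_iff.1 hzM' _ (sub_mem (one_mem M) (mul_mem hws hw))
  rw [c3, hze] at hfinal
  exact (sub_eq_zero.1 hfinal).symm


/- STATEMENT 9: Let M be a finite von Neumann algebra (finiteness: every isometry in M is a
unitary) with a (normal) tracial state τ, and let a ∈ M satisfy ‖a*a − 1‖_τ < δ, where
‖x‖_τ = τ(x*x)^{1/2}.  Then there exists a unitary v ∈ M with ‖a − v‖_τ < (3 + ‖a‖)δ. -/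
theorem almost_isometry_close_to_unitary
    {H : Type*} [NormedAddCommGroup H] [InnerProductSpace ℂ H] [CompleteSpace H]
    (M : VonNeumannAlgebra H)
    (hfin : ∀ v ∈ M, star v * v = 1 → v * star v = 1)
    (τ : (H →L[ℂ] H) →ₗ[ℂ] ℂ)
    (hτ1 : τ 1 = 1)
    (hτpos : ∀ x, 0 ≤ (τ (star x * x)).re ∧ (τ (star x * x)).im = 0)
    (hτtr : ∀ x ∈ M, ∀ y ∈ M, τ (x * y) = τ (y * x))
    (a : H →L[ℂ] H) (ha : a ∈ M) (δ : ℝ)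
    (hδ : Real.sqrt (τ (star (star a * a - 1) * (star a * a - 1))).re < δ) :
    ∃ v ∈ M, star v * v = 1 ∧ v * star v = 1 ∧
      Real.sqrt (τ (star (a - v) * (a - v))).re < (3 + ‖a‖) * δ := by
  obtain ⟨G, hG0, hG⟩ := aux_zorn M _ (aux_graph_good M a ha)
  obtain ⟨v, hv, hpi, hvG⟩ := aux_partial_isometry M G hG.1 (aux_closed M G hG)
  have h1 : star v * v = 1 := aux_isometry M hfin v hv hpi
    (fun s hs h1 h2 => aux_maximal M G hG v hvG s hs h1 h2)
  refine ⟨v, hv, h1, hfin v hv h1, ?_⟩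
  have hva : v * CFC.abs a = a :=
    ContinuousLinearMap.ext fun x => (hvG _ (hG0 ⟨x, rfl⟩)).1
  set b := CFC.abs a with hb
  have hb0 : 0 ≤ b := CFC.abs_nonneg a
  have hbs : star b = b := (IsSelfAdjoint.of_nonneg hb0).star_eq
  have hbb : star a * a = b * b := (CFC.abs_mul_abs a).symm
  set r := CFC.sqrt b with hr
  have hrr : r * r = b := CFC.sqrt_mul_sqrt_self b hb0
  have hrs : star r = r := (IsSelfAdjoint.of_nonneg (CFC.sqrt_nonneg b)).star_eq
  have e1 : star (a - v) * (a - v) = (b - 1) * (b - 1) := by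
    have : a - v = v * (b - 1) := by rw [mul_sub, hva, mul_one]
    rw [this, star_mul, mul_assoc, ← mul_assoc (star v), h1, one_mul, star_sub, hbs, star_one]
  have e2 : star (star a * a - 1) * (star a * a - 1) = star (a - v) * (a - v)
      + star (b * (b - 1)) * (b * (b - 1)) + (star (r * (b - 1)) * (r * (b - 1))
      + star (r * (b - 1)) * (r * (b - 1))) := by
    rw [e1, hbb]
    simp only [star_mul, star_sub, star_one, hbs, hrs]
    have : (b - 1) * r * (r * (b - 1)) = (b - 1) * b * (b - 1) := by
      rw [← hrr]; noncomm_ring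
    rw [this]
    noncomm_ring
  have hle : (τ (star (a - v) * (a - v))).re
      ≤ (τ (star (star a * a - 1) * (star a * a - 1))).re := by
    rw [e2, map_add, map_add, map_add, Complex.add_re, Complex.add_re, Complex.add_re]
    have := (hτpos (b * (b - 1))).1
    have := (hτpos (r * (b - 1))).1
    linarith
  have hδ0 : 0 < δ := (Real.sqrt_nonneg _).trans_lt hδ
  calc _ ≤ _ := Real.sqrt_le_sqrt hle
    _ < δ := hδ
    _ ≤ (3 + ‖a‖) * δ := by nlinarith [norm_nonneg a, mul_nonneg (norm_nonneg a) hδ0.le]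
end
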